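/- arXiv:1801.07808 — 4 statements merged into one kernel-verified Lean document; each statement's English description precedes it below -/
import Mathlib

section
/- For every finite connected simple graph G, the pebbling number satisfies π(G) ≤ 2^{|G|−1}. -/
/-- A single pebbling move on `G`: remove two pebbles from a vertex `u`
and place one pebble on an adjacent vertex `v`. -/
def PebblingStep {V : Type*} [DecidableEq V] (G : SimpleGraph V) (C C' : V → ℕ) : Prop :=
  ∃ u v, G.Adj u v ∧ 2 ≤ C u ∧
    C' = Function.update (Function.update C u (C u - 2)) v (C v + 1)

/-- Configuration `C` is `k`-fold `r`-solvable on `G`: some sequence of pebbling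
moves results in at least `k` pebbles on `r`. -/
def PebbSolvable {V : Type*} [DecidableEq V] (G : SimpleGraph V) (C : V → ℕ) (r : V)
    (k : ℕ) : Prop :=
  ∃ C', Relation.ReflTransGen (PebblingStep G) C C' ∧ k ≤ C' r

/-- The `k`-fold pebbling number of `G`: the least `n` such that for every root `r`,
every configuration of size at least `n` is `k`-fold `r`-solvable. -/
noncomputable def kPebblingNumber {V : Type*} [Fintype V] [DecidableEq V]
    (G : SimpleGraph V) (k : ℕ) : ℕ :=
  sInf {n | ∀ (r : V) (C : V → ℕ), n ≤ ∑ v, C v → PebbSolvable G C r k}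

/-- The pebbling number of `G`. -/
noncomputable def pebblingNumber {V : Type*} [Fintype V] [DecidableEq V]
    (G : SimpleGraph V) : ℕ :=
  kPebblingNumber G 1

/-- Performing `m` pebbling moves along one edge `u ~ v`. -/
theorem reflTransGen_pebblingStep_of_adj {V : Type*} [DecidableEq V] {G : SimpleGraph V}
    {u v : V} (h : G.Adj u v) (m : ℕ) (C : V → ℕ) (hm : 2 * m ≤ C u) :
    Relation.ReflTransGen (PebblingStep G) C
      (Function.update (Function.update C u (C u - 2 * m)) v (C v + m)) := by
  induction m with
  | zero => simpa using Relation.ReflTransGen.refl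
  | succ m ih =>
    refine (ih (by omega)).tail ⟨u, v, h, ?_, ?_⟩
    · simp only [Function.update_of_ne h.ne, Function.update_self]
      omega
    · funext x
      have hne := h.ne
      simp only [Function.update_apply]
      grind

/-- In a connected graph every vertex other than `r` has a neighbour closer to `r`. -/
theorem SimpleGraph.Connected.exists_adj_dist_lt {V : Type*} {G : SimpleGraph V}
    (hG : G.Connected) {r v : V} (hv : v ≠ r) :
    ∃ w, G.Adj v w ∧ G.dist w r < G.dist v r := by
  obtain ⟨p, hp⟩ := hG.exists_walk_length_eq_dist v r
  cases p with
  | nil => exact absurd rfl hv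
  | cons h q =>
    refine ⟨_, h, ?_⟩
    have := SimpleGraph.dist_le q
    rw [SimpleGraph.Walk.length_cons] at hp
    omega

/-- If every vertex of `S` other than `r` has a neighbour in `S` of smaller rank, then
`2 ^ (|S| - 1)` pebbles on `S` suffice to reach `r`. -/
theorem pebbSolvable_of_two_pow_le_sum {V : Type*} [DecidableEq V] {G : SimpleGraph V}
    {r : V} (d : V → ℕ) (n : ℕ) (S : Finset V) (hcard : S.card = n + 1) (hr : r ∈ S)
    (hS : ∀ v ∈ S, v ≠ r → ∃ w ∈ S, G.Adj v w ∧ d w < d v)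
    (C : V → ℕ) (hC : 2 ^ n ≤ ∑ v ∈ S, C v) : PebbSolvable G C r 1 := by
  induction n generalizing S C with
  | zero =>
    obtain ⟨a, rfl⟩ := Finset.card_eq_one.mp hcard
    obtain rfl := Finset.mem_singleton.mp hr
    exact ⟨C, .refl, by simpa using hC⟩
  | succ n ih =>
    obtain ⟨v, hv, hmax⟩ : ∃ v ∈ S.erase r, ∀ w ∈ S.erase r, d w ≤ d v :=
      Finset.exists_max_image _ d
        (Finset.card_pos.mp (by rw [Finset.card_erase_of_mem hr]; omega))
    obtain ⟨hvr, hvS⟩ := Finset.mem_erase.mp hv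
    obtain ⟨u, huS, hadj, -⟩ := hS v hvS hvr
    have huS' : u ∈ S.erase v := Finset.mem_erase.mpr ⟨hadj.ne', huS⟩
    have hmoves := reflTransGen_pebblingStep_of_adj hadj (C v / 2) C (by omega)
    set D := Function.update (Function.update C v (C v - 2 * (C v / 2))) u (C u + C v / 2)
      with hD
    have hsum : ∑ x ∈ S.erase v, D x = ∑ x ∈ S.erase v, C x + C v / 2 := by
      rw [← Finset.add_sum_erase _ _ huS', ← Finset.add_sum_erase _ C huS']
      have hrest : ∑ x ∈ (S.erase v).erase u, D x = ∑ x ∈ (S.erase v).erase u, C x := by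
        refine Finset.sum_congr rfl fun x hx => ?_
        simp only [Finset.mem_erase] at hx
        simp [hD, hx.1, hx.2.1]
      rw [hrest, hD, Function.update_self]
      omega
    rw [← Finset.add_sum_erase _ _ hvS, pow_succ] at hC
    obtain ⟨C', hC', hle⟩ := ih (S.erase v)
      (by rw [Finset.card_erase_of_mem hvS]; omega)
      (Finset.mem_erase.mpr ⟨hvr.symm, hr⟩)
      (fun x hx hxr => by
        obtain ⟨-, hxS⟩ := Finset.mem_erase.mp hx
        obtain ⟨w, hwS, hxw, hlt⟩ := hS x hxS hxr
        have hxv := hmax x (Finset.mem_erase.mpr ⟨hxr, hxS⟩)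
        refine ⟨w, Finset.mem_erase.mpr ⟨?_, hwS⟩, hxw, hlt⟩
        rintro rfl
        omega)
      D (by rw [hsum]; omega)
    exact ⟨C', hmoves.trans hC', hle⟩

/-- For every finite connected simple graph `G`, `π(G) ≤ 2 ^ (|G| - 1)`. -/
theorem pebblingNumber_le_two_pow {V : Type*} [Fintype V] [DecidableEq V]
    (G : SimpleGraph V) (hG : G.Connected) :
    pebblingNumber G ≤ 2 ^ (Fintype.card V - 1) := by
  refine Nat.sInf_le fun r C hC => ?_
  have : Nonempty V := ⟨r⟩
  refine pebbSolvable_of_two_pow_le_sum (G.dist · r) (Fintype.card V - 1) Finset.univ ?_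
    (Finset.mem_univ r) (fun v _ hv => ?_) C hC
  · rw [Finset.card_univ, Nat.sub_add_cancel Fintype.card_pos]
  · obtain ⟨w, hw⟩ := hG.exists_adj_dist_lt hv
    exact ⟨w, Finset.mem_univ w, hw⟩
end

section
/- Let G and H be finite connected simple graphs. Then π(G □ H) ≤ (π(G) + |G|)·π(H). -/
/-- From `C` one can reach, by pebbling moves, a configuration dominating `D`. -/
def PebbReaches {V : Type*} [DecidableEq V] (G : SimpleGraph V) (C D : V → ℕ) : Prop :=
  ∃ C', Relation.ReflTransGen (PebblingStep G) C C' ∧ D ≤ C'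

/-- The image of a configuration under a map of vertices. -/
def pushConfig {V P : Type*} [Fintype V] [DecidableEq P] (f : V → P) (C : V → ℕ) : P → ℕ :=
  ∑ v, Pi.single (f v) (C v)

section Step

variable {V : Type*} [DecidableEq V] {G : SimpleGraph V}

theorem pebblingStep_iff {C C' : V → ℕ} :
    PebblingStep G C C' ↔
      ∃ (u v : V) (X : V → ℕ), G.Adj u v ∧ C = X + Pi.single u 2 ∧ C' = X + Pi.single v 1 := by
  constructor
  · rintro ⟨u, v, huv, h2, rfl⟩
    refine ⟨u, v, Function.update C u (C u - 2), huv, ?_, ?_⟩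
    · ext w
      by_cases hw : w = u
      · subst hw; simp; omega
      · simp [hw]
    · ext w
      by_cases hw : w = v
      · subst hw; simp [huv.ne']
      · simp [hw]
  · rintro ⟨u, v, X, huv, rfl, rfl⟩
    refine ⟨u, v, huv, by simp, ?_⟩
    ext w
    by_cases hw : w = v
    · subst hw; simp [huv.ne']
    · by_cases hu : w = u
      · subst hu; simp [huv.ne]
      · simp [hw, hu]

theorem PebblingStep.add_right {C C' : V → ℕ} (h : PebblingStep G C C') (D : V → ℕ) :
    PebblingStep G (C + D) (C' + D) := by
  obtain ⟨u, v, X, huv, rfl, rfl⟩ := pebblingStep_iff.1 h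
  exact pebblingStep_iff.2 ⟨u, v, X + D, huv, add_right_comm _ _ _, add_right_comm _ _ _⟩

theorem pebbSolvable_iff_pebbReaches {C : V → ℕ} {r : V} {k : ℕ} :
    PebbSolvable G C r k ↔ PebbReaches G C (Pi.single r k) := by
  refine exists_congr fun C' => and_congr_right fun _ => ⟨fun h w => ?_, fun h => ?_⟩
  · by_cases hw : w = r
    · subst hw; simpa using h
    · simp [hw]
  · simpa using h r

namespace PebbReaches

theorem of_le {C D : V → ℕ} (h : D ≤ C) : PebbReaches G C D :=
  ⟨C, .refl, h⟩

theorem add_right {C D : V → ℕ} (h : PebbReaches G C D) (E : V → ℕ) :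
    PebbReaches G (C + E) (D + E) := by
  obtain ⟨C', hC, hD⟩ := h
  exact ⟨C' + E, hC.lift (· + E) fun _ _ h => h.add_right E, add_le_add_left hD E⟩

theorem trans {C D E : V → ℕ} (h₁ : PebbReaches G C D) (h₂ : PebbReaches G D E) :
    PebbReaches G C E := by
  obtain ⟨C', hC, hD⟩ := h₁
  obtain ⟨X, rfl⟩ := exists_add_of_le hD
  obtain ⟨E', hE, hle⟩ := h₂.add_right X
  exact ⟨E', hC.trans hE, le_trans le_self_add hle⟩

theorem add {C D C' D' : V → ℕ} (h : PebbReaches G C D) (h' : PebbReaches G C' D') :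
    PebbReaches G (C + C') (D + D') := by
  refine (h.add_right C').trans ?_
  rw [add_comm D, add_comm D]
  exact h'.add_right D

theorem sum {ι : Type*} (s : Finset ι) {C D : ι → V → ℕ}
    (h : ∀ i ∈ s, PebbReaches G (C i) (D i)) : PebbReaches G (∑ i ∈ s, C i) (∑ i ∈ s, D i) := by
  classical
  induction s using Finset.induction_on with
  | empty => exact of_le (by simp)
  | insert i s hi ih =>
    rw [Finset.sum_insert hi, Finset.sum_insert hi]
    exact (h i (Finset.mem_insert_self i s)).add
      (ih fun j hj => h j (Finset.mem_insert_of_mem hj))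

end PebbReaches

theorem PebbReaches.single_of_adj {u v : V} (huv : G.Adj u v) (k : ℕ) :
    PebbReaches G (Pi.single u (2 * k)) (Pi.single v k) := by
  induction k with
  | zero => exact of_le (by simp)
  | succ k ih =>
    rw [mul_add, Pi.single_add, Pi.single_add]
    exact ih.add ⟨_, .single (pebblingStep_iff.2 ⟨u, v, 0, huv, by simp, rfl⟩), by simp⟩

theorem PebbReaches.single_of_walk {u v : V} (p : G.Walk u v) (k : ℕ) :
    PebbReaches G (Pi.single u (2 ^ p.length * k)) (Pi.single v k) := by
  induction p with
  | nil => exact of_le (by simp)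
  | cons h p ih =>
    rw [SimpleGraph.Walk.length_cons, pow_succ', mul_assoc]
    exact (single_of_adj h _).trans ih

end Step

section Push

variable {V P : Type*} [Fintype V] [DecidableEq P]

theorem pushConfig_add (f : V → P) (C D : V → ℕ) :
    pushConfig f (C + D) = pushConfig f C + pushConfig f D := by
  simp [pushConfig, Pi.single_add, Finset.sum_add_distrib]

variable [DecidableEq V]

theorem pushConfig_single (f : V → P) (v : V) (k : ℕ) :
    pushConfig f (Pi.single v k) = Pi.single (f v) k := by
  rw [pushConfig, Finset.sum_eq_single v] <;> simp +contextual

theorem PebbReaches.map {G : SimpleGraph V} {K : SimpleGraph P} (f : G →g K) {C D : V → ℕ}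
    (h : PebbReaches G C D) : PebbReaches K (pushConfig f C) (pushConfig f D) := by
  obtain ⟨C', hC, hD⟩ := h
  refine ⟨pushConfig f C', hC.lift (pushConfig f) fun A B hAB => ?_, ?_⟩
  · obtain ⟨u, v, X, huv, rfl, rfl⟩ := pebblingStep_iff.1 hAB
    exact pebblingStep_iff.2 ⟨f u, f v, pushConfig f X, f.map_adj huv,
      by rw [pushConfig_add, pushConfig_single], by rw [pushConfig_add, pushConfig_single]⟩
  · obtain ⟨X, rfl⟩ := exists_add_of_le hD
    rw [pushConfig_add]
    exact le_self_add

theorem sum_pushConfig_mk {W : Type*} [Fintype W] [DecidableEq W] (C : V × W → ℕ) :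
    ∑ g, pushConfig (Prod.mk g) (fun h => C (g, h)) = C :=
  (Fintype.sum_prod_type fun p => Pi.single p (C p)).symm.trans (Finset.univ_sum_single C)

end Push

section PebblingNumber

variable {V : Type*} [Fintype V] [DecidableEq V] {G : SimpleGraph V}

theorem exists_le_sum_eq (C : V → ℕ) {n : ℕ} (hn : n ≤ ∑ v, C v) :
    ∃ D ≤ C, ∑ v, D v = n := by
  induction n with
  | zero => exact ⟨0, fun _ => Nat.zero_le _, by simp⟩
  | succ n ih =>
    obtain ⟨D, hD, rfl⟩ := ih (by omega)
    obtain ⟨v, -, hv⟩ := Finset.exists_lt_of_sum_lt (Nat.lt_of_succ_le hn)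
    refine ⟨D + Pi.single v 1, fun w => ?_, by simp [Finset.sum_add_distrib]⟩
    by_cases hw : w = v
    · subst hw; simpa using hv
    · simpa [hw] using hD w

theorem pebbReaches_of_pebblingNumber_le (hG : G.Connected) (r : V) (C : V → ℕ)
    (hC : pebblingNumber G ≤ ∑ v, C v) : PebbReaches G C (Pi.single r 1) := by
  rw [← pebbSolvable_iff_pebbReaches]
  refine Nat.sInf_mem
    (s := {n | ∀ (r : V) (C : V → ℕ), n ≤ ∑ v, C v → PebbSolvable G C r 1}) ?_ r C hC
  choose p _ using fun u v : V => hG.exists_walk_length_eq_dist u v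
  refine ⟨∑ r, ∑ u, 2 ^ (p u r).length, fun r C hC => ?_⟩
  have hle : ∑ u, 2 ^ (p u r).length ≤ ∑ u, C u :=
    (Finset.single_le_sum (f := fun r => ∑ u, 2 ^ (p u r).length)
      (fun _ _ => Nat.zero_le _) (Finset.mem_univ r)).trans hC
  obtain ⟨u, -, hu⟩ := Finset.exists_le_of_sum_le ⟨r, Finset.mem_univ r⟩ hle
  rw [pebbSolvable_iff_pebbReaches]
  refine PebbReaches.trans (PebbReaches.of_le fun w => ?_) (PebbReaches.single_of_walk (p u r) 1)
  by_cases hw : w = u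
  · subst hw; simpa using hu
  · simp [hw]

theorem pebblingNumber_pos (hG : G.Connected) : 0 < pebblingNumber G := by
  by_contra! h
  obtain ⟨r⟩ := hG.nonempty
  obtain ⟨C', hC', hr⟩ := pebbReaches_of_pebblingNumber_le hG r 0 (by simpa using h)
  rcases hC'.cases_head with rfl | ⟨D, ⟨u, v, -, h2, -⟩, -⟩
  · simpa using hr r
  · simp at h2

theorem pebbReaches_of_mul_pebblingNumber_le (hG : G.Connected) (r : V) (k : ℕ) (C : V → ℕ)
    (hC : k * pebblingNumber G ≤ ∑ v, C v) : PebbReaches G C (Pi.single r k) := by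
  induction k generalizing C with
  | zero => exact .of_le (by simp)
  | succ k ih =>
    rw [add_mul, one_mul] at hC
    obtain ⟨D, hD, hsum⟩ := exists_le_sum_eq C (le_of_add_le_left hC)
    obtain ⟨E, rfl⟩ := exists_add_of_le hD
    rw [Pi.single_add]
    refine (ih D hsum.ge).add (pebbReaches_of_pebblingNumber_le hG r E ?_)
    simp only [Pi.add_apply, Finset.sum_add_distrib] at hC
    omega

end PebblingNumber

/-- For connected graphs `G`, `H`: `π(G □ H) ≤ (π(G) + |G|) · π(H)`. -/
theorem pebblingNumber_boxProd_le {V W : Type*} [Fintype V] [DecidableEq V]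
    [Fintype W] [DecidableEq W] (G : SimpleGraph V) (H : SimpleGraph W)
    (hG : G.Connected) (hH : H.Connected) :
    pebblingNumber (G.boxProd H) ≤ (pebblingNumber G + Fintype.card V) * pebblingNumber H := by
  refine Nat.sInf_le ?_
  rintro ⟨g₀, h₀⟩ C hC
  rw [pebbSolvable_iff_pebbReaches]
  have hpos := pebblingNumber_pos hH
  set q := pebblingNumber H
  let k : V → ℕ := fun g => (∑ h, C (g, h)) / q
  have hrows : PebbReaches (G.boxProd H) C (pushConfig (fun g => (g, h₀)) k) := by
    rw [← sum_pushConfig_mk C, pushConfig]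
    refine PebbReaches.sum _ fun g _ => ?_
    rw [← pushConfig_single (Prod.mk g)]
    exact PebbReaches.map (G.boxProdRight H g).toHom
      (pebbReaches_of_mul_pebblingNumber_le hH h₀ _ _ (Nat.div_mul_le_self _ _))
  have hk : pebblingNumber G ≤ ∑ g, k g := by
    have hlt : ∑ g, ∑ h, C (g, h) ≤ (∑ g, k g + Fintype.card V) * q := by
      rw [← Finset.card_univ, Finset.card_eq_sum_ones, ← Finset.sum_add_distrib, Finset.sum_mul]
      exact Finset.sum_le_sum fun g _ => (Nat.lt_mul_of_div_lt (Nat.lt_succ_self _) hpos).le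
    rw [← Fintype.sum_prod_type] at hlt
    have := Nat.le_of_mul_le_mul_right (hC.trans hlt) hpos
    omega
  have hcol := PebbReaches.map (G.boxProdLeft H h₀).toHom
    (pebbReaches_of_pebblingNumber_le hG g₀ k hk)
  rw [pushConfig_single] at hcol
  exact hrows.trans hcol
end

section
/- Let G and H be finite connected simple graphs. If H is frugal, then π(G □ H) ≤ 2^{diam(H)}·π(G) + |G|·π(H). -/
open Relation Function

lemma Function.extend_comp_self {V W : Type*} (φ : V → W) (E : W → ℕ) :
    extend φ (E ∘ φ) E = E := by
  classical
  ext x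
  simp only [extend_def, comp_apply]
  split_ifs with h
  · rw [h.choose_spec]
  · rfl

section Pebbling

variable {V W : Type*} [DecidableEq V] [DecidableEq W] {G : SimpleGraph V} {H : SimpleGraph W}

/-- A pebbling move on a graph embedded in another one is a move of the ambient graph. -/
lemma PebblingStep.extend {φ : V → W} (hφ : Injective φ)
    (hadj : ∀ u v, G.Adj u v → H.Adj (φ u) (φ v)) {C C' : V → ℕ} (E : W → ℕ)
    (h : PebblingStep G C C') : PebblingStep H (extend φ C E) (extend φ C' E) := by
  obtain ⟨u, v, huv, h2, rfl⟩ := h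
  refine ⟨φ u, φ v, hadj u v huv, by rwa [hφ.extend_apply], ?_⟩
  ext x
  by_cases hx : ∃ a, φ a = x
  · obtain ⟨a, rfl⟩ := hx
    simp only [hφ.extend_apply, update_apply, hφ.eq_iff]
  · have hne : ∀ a, x ≠ φ a := fun a ha => hx ⟨a, ha.symm⟩
    rw [extend_apply' _ _ _ hx, update_of_ne (hne v), update_of_ne (hne u),
      extend_apply' _ _ _ hx]

/-- Solving the pulled back configuration on an embedded graph solves the ambient one,
leaving the vertices outside the embedded graph untouched. -/
lemma PebbSolvable.exists_of_injective {φ : V → W} (hφ : Injective φ)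
    (hadj : ∀ u v, G.Adj u v → H.Adj (φ u) (φ v)) {E : W → ℕ} {r : V} {k : ℕ}
    (h : PebbSolvable G (E ∘ φ) r k) :
    ∃ E', ReflTransGen (PebblingStep H) E E' ∧ k ≤ E' (φ r) ∧
      ∀ x, (¬ ∃ a, φ a = x) → E' x = E x := by
  obtain ⟨C', hC', hk⟩ := h
  refine ⟨extend φ C' E, ?_, by rwa [hφ.extend_apply], fun x hx => extend_apply' _ _ _ hx⟩
  have := hC'.lift (fun C => extend φ C E) (fun _ _ hs => hs.extend hφ hadj E)
  simpa only [onFun, extend_comp_self] using this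

/-- Moving `m` pebbles across an edge. -/
lemma exists_reflTransGen_pebblingStep_of_adj {u v : V} (huv : G.Adj u v) (m : ℕ) :
    ∀ C : V → ℕ, 2 * m ≤ C u → ∃ C', ReflTransGen (PebblingStep G) C C' ∧ m ≤ C' v := by
  suffices h : ∀ C : V → ℕ, 2 * m ≤ C u →
      ∃ C', ReflTransGen (PebblingStep G) C C' ∧ C v + m ≤ C' v from fun C hC =>
    (h C hC).imp fun _ h' => ⟨h'.1, by omega⟩
  induction m with
  | zero => exact fun C _ => ⟨C, .refl, le_rfl⟩
  | succ m ih =>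
    intro C hC
    obtain ⟨C', hC', hm⟩ := ih (update (update C u (C u - 2)) v (C v + 1)) (by
      rw [update_of_ne huv.ne, update_self]; omega)
    rw [update_self] at hm
    exact ⟨C', .head ⟨u, v, huv, by omega, rfl⟩ hC', by omega⟩

lemma SimpleGraph.Walk.pebbSolvable {u r : V} (p : G.Walk u r) (k : ℕ) :
    ∀ C : V → ℕ, 2 ^ p.length * k ≤ C u → PebbSolvable G C r k := by
  induction p with
  | nil => exact fun C hC => ⟨C, .refl, by simpa using hC⟩
  | cons huv p ih =>
    intro C hC
    obtain ⟨C₁, h₁, hle⟩ := exists_reflTransGen_pebblingStep_of_adj huv (2 ^ p.length * k) C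
      (by rw [SimpleGraph.Walk.length_cons, pow_succ] at hC; linarith)
    obtain ⟨C₂, h₂, hk⟩ := ih C₁ hle
    exact ⟨C₂, h₁.trans h₂, hk⟩

/-- On a finite connected graph, sufficiently large configurations are `k`-fold solvable. -/
lemma SimpleGraph.Connected.exists_pebbSolvable [Fintype V] (hG : G.Connected) (k : ℕ) :
    ∃ n, ∀ (r : V) (C : V → ℕ), n ≤ ∑ v, C v → PebbSolvable G C r k := by
  have := hG.nonempty
  refine ⟨Fintype.card V * (2 ^ Fintype.card V * k), fun r C hC => ?_⟩
  obtain ⟨u, -, hu⟩ : ∃ u ∈ Finset.univ, 2 ^ Fintype.card V * k ≤ C u :=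
    Finset.exists_le_of_sum_le Finset.univ_nonempty (by simpa using hC)
  obtain ⟨p, hp⟩ := (hG u r).exists_isPath
  refine p.pebbSolvable k C (le_trans ?_ hu)
  gcongr
  · norm_num
  · exact hp.length_lt.le

lemma SimpleGraph.Connected.pebbSolvable_of_kPebblingNumber_le [Fintype V] (hG : G.Connected)
    {k : ℕ} (r : V) {C : V → ℕ} (hC : kPebblingNumber G k ≤ ∑ v, C v) : PebbSolvable G C r k :=
  Nat.sInf_mem (hG.exists_pebbSolvable k) r C hC

/-- The fibres over the vertices of `G` can be solved independently of each other. -/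
lemma exists_reflTransGen_boxProd_of_fibers {E : V × W → ℕ} {h : W} {k : V → ℕ}
    (hk : ∀ v, PebbSolvable H (E ∘ Prod.mk v) h (k v)) (s : Finset V) :
    ∃ E', ReflTransGen (PebblingStep (G.boxProd H)) E E' ∧ (∀ v ∈ s, k v ≤ E' (v, h)) ∧
      ∀ v ∉ s, ∀ w, E' (v, w) = E (v, w) := by
  induction s using Finset.induction_on with
  | empty => exact ⟨E, .refl, by simp, fun _ _ _ => rfl⟩
  | insert a s ha ih =>
    obtain ⟨E₁, h₁, hs, hout⟩ := ih
    have hE : E₁ ∘ Prod.mk a = E ∘ Prod.mk a := funext (hout a ha)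
    obtain ⟨E₂, h₂, hka, hne⟩ := PebbSolvable.exists_of_injective (H := G.boxProd H)
      (Prod.mk_right_injective a) (fun u v huv => by simpa using huv) (hE ▸ hk a)
    have hfix : ∀ v, v ≠ a → ∀ w, E₂ (v, w) = E₁ (v, w) := fun v hv w =>
      hne _ (by rintro ⟨w', hw⟩; exact hv (Prod.ext_iff.1 hw).1.symm)
    refine ⟨E₂, h₁.trans h₂, fun v hv => ?_, fun v hv w => ?_⟩
    · by_cases hva : v = a
      · exact hva ▸ hka
      · rw [hfix v hva]
        exact hs v ((Finset.mem_insert.1 hv).resolve_left hva)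
    · rw [Finset.mem_insert, not_or] at hv
      rw [hfix v hv.1, hout v hv.2]

/-- In a frugal graph, every configuration yields at least as many pebbles on the root as
`2 ^ H.diam` goes into its excess over the pebbling number. -/
lemma exists_pebbSolvable_of_frugal [Fintype W] (hH : H.Connected)
    (hfrugal : ∀ k : ℕ, 1 ≤ k →
      kPebblingNumber H k ≤ pebblingNumber H + (k - 1) * 2 ^ H.diam) (r : W) (C : W → ℕ) :
    ∃ k, PebbSolvable H C r k ∧ ∑ w, C w ≤ pebblingNumber H + k * 2 ^ H.diam := by
  by_cases hlt : ∑ w, C w < pebblingNumber H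
  · exact ⟨0, ⟨C, .refl, Nat.zero_le _⟩, by omega⟩
  · have hpos : 0 < 2 ^ H.diam := by positivity
    refine ⟨(∑ w, C w - pebblingNumber H) / 2 ^ H.diam + 1,
      hH.pebbSolvable_of_kPebblingNumber_le r ((hfrugal _ (Nat.le_add_left 1 _)).trans ?_), ?_⟩
    · have := Nat.div_mul_le_self (∑ w, C w - pebblingNumber H) (2 ^ H.diam)
      rw [Nat.add_sub_cancel]
      omega
    · have := Nat.lt_div_mul_add (a := ∑ w, C w - pebblingNumber H) hpos
      rw [add_mul, one_mul]
      omega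

end Pebbling

/-- For connected graphs `G`, `H` with `H` frugal:
`π(G □ H) ≤ 2^{diam(H)} · π(G) + |G| · π(H)`. -/
theorem pebblingNumber_boxProd_le_of_frugal {V W : Type*} [Fintype V] [DecidableEq V]
    [Fintype W] [DecidableEq W] (G : SimpleGraph V) (H : SimpleGraph W)
    (hG : G.Connected) (hH : H.Connected)
    (hfrugal : ∀ k : ℕ, 1 ≤ k →
      kPebblingNumber H k ≤ pebblingNumber H + (k - 1) * 2 ^ H.diam) :
    pebblingNumber (G.boxProd H) ≤
      2 ^ H.diam * pebblingNumber G + Fintype.card V * pebblingNumber H := by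
  refine Nat.sInf_le ?_
  rintro ⟨g, h⟩ E hE
  choose k hk hle using fun v => exists_pebbSolvable_of_frugal hH hfrugal h (E ∘ Prod.mk v)
  obtain ⟨E₁, h₁, hE₁, -⟩ := exists_reflTransGen_boxProd_of_fibers (G := G) hk Finset.univ
  have hsum : ∑ x, E x ≤ Fintype.card V * pebblingNumber H + (∑ v, k v) * 2 ^ H.diam := by
    rw [Fintype.sum_prod_type]
    refine (Finset.sum_le_sum fun v _ => hle v).trans_eq ?_
    rw [Finset.sum_add_distrib, Finset.sum_mul]
    simp
  have hk_sum : pebblingNumber G ≤ ∑ v, k v := by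
    refine Nat.le_of_mul_le_mul_left (c := 2 ^ H.diam) ?_ (by positivity)
    linarith
  have hsolv : PebbSolvable G (E₁ ∘ fun v => (v, h)) g 1 :=
    hG.pebbSolvable_of_kPebblingNumber_le g
      (hk_sum.trans (Finset.sum_le_sum fun v hv => hE₁ v hv))
  obtain ⟨E₂, h₂, hge, -⟩ := hsolv.exists_of_injective (H := G.boxProd H)
    (Prod.mk_left_injective h) (fun u v huv => by simpa using huv)
  exact ⟨E₂, h₁.trans h₂, hge⟩
end

section
/- Let G be a finite connected simple graph and H any finite simple graph. In the corona G ⋈ H: (a) any configuration placing at least 2·π(G) pebbles on the vertices of the copy of G is r-solvable for every root r of G ⋈ H; (b) if the root r lies in a copy of H and at least π(G) + 1 pebbles are on the vertices of the copy of G, with at least one pebble on the vertex of G adjacent to r, then a pebble can be moved to r. -/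
/-- The corona `G ⋈ H`: one copy of `G` and `|G|` disjoint copies of `H`, where the
vertex `g` of `G` is joined to every vertex of its own copy `{g} × V(H)` of `H`. -/
def corona {V W : Type*} (G : SimpleGraph V) (H : SimpleGraph W) :
    SimpleGraph (V ⊕ V × W) :=
  SimpleGraph.fromRel (fun x y =>
    match x, y with
    | Sum.inl g, Sum.inl g' => G.Adj g g'
    | Sum.inl g, Sum.inr (g', _) => g = g'
    | Sum.inr (g, h), Sum.inr (g', h') => g = g' ∧ H.Adj h h'
    | _, _ => False)

theorem sum_add_sum_tsub {ι : Type*} [Fintype ι] {A C : ι → ℕ} (h : A ≤ C) :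
    ∑ v, A v + ∑ v, (C - A) v = ∑ v, C v := by
  rw [← Finset.sum_add_distrib]
  exact Finset.sum_congr rfl fun v _ => Nat.add_sub_of_le (h v)

theorem exists_le_sum_eq_s13 {ι : Type*} [Fintype ι] [DecidableEq ι] (C : ι → ℕ) {n : ℕ}
    (h : n ≤ ∑ v, C v) : ∃ A ≤ C, ∑ v, A v = n := by
  induction n with
  | zero => exact ⟨0, fun _ => Nat.zero_le _, by simp⟩
  | succ n ih =>
    obtain ⟨A, hA, hn⟩ := ih (Nat.le_of_succ_le h)
    obtain ⟨v, -, hv⟩ := Finset.exists_lt_of_sum_lt (hn ▸ h : ∑ v, A v < ∑ v, C v)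
    refine ⟨A + Pi.single v 1, fun x => ?_, by simp [Finset.sum_add_distrib, hn]⟩
    by_cases hx : x = v
    · subst hx
      simpa using hv
    · simpa [hx] using hA x

section Pebbling

variable {V : Type*} [DecidableEq V] {G : SimpleGraph V}

theorem reflTransGen_pebblingStep_add_right {C C' : V → ℕ}
    (h : Relation.ReflTransGen (PebblingStep G) C C') (D : V → ℕ) :
    Relation.ReflTransGen (PebblingStep G) (C + D) (C' + D) :=
  Relation.ReflTransGen.lift (· + D) (fun _ _ hs => PebblingStep.add_right hs D) _ _ h

theorem PebbSolvable.of_le {C : V → ℕ} {r : V} {k : ℕ} (h : k ≤ C r) :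
    PebbSolvable G C r k :=
  ⟨C, .refl, h⟩

theorem PebbSolvable.of_reflTransGen {C C' : V → ℕ} {r : V} {k : ℕ}
    (h : Relation.ReflTransGen (PebblingStep G) C C') (h' : PebbSolvable G C' r k) :
    PebbSolvable G C r k := by
  obtain ⟨C'', hC, hk⟩ := h'
  exact ⟨C'', h.trans hC, hk⟩

theorem PebbSolvable.add {A B : V → ℕ} {r : V} {k l : ℕ}
    (hA : PebbSolvable G A r k) (hB : PebbSolvable G B r l) :
    PebbSolvable G (A + B) r (k + l) := by
  obtain ⟨A', hA, hk⟩ := hA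
  obtain ⟨B', hB, hl⟩ := hB
  refine ⟨A' + B', (reflTransGen_pebblingStep_add_right hA B).trans ?_, Nat.add_le_add hk hl⟩
  rw [add_comm A' B, add_comm A' B']
  exact reflTransGen_pebblingStep_add_right hB A'

/-- Pebbles gathered on a vertex can be moved, at half their number, to any neighbour. -/
theorem exists_reflTransGen_of_adj {u v : V} (huv : G.Adj u v) (m : ℕ) (C : V → ℕ)
    (h : 2 * m ≤ C u) :
    ∃ C', Relation.ReflTransGen (PebblingStep G) C C' ∧ m ≤ C' v := by
  induction m generalizing C with
  | zero => exact ⟨C, .refl, Nat.zero_le _⟩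
  | succ m ih =>
    have hA : PebbSolvable G (Pi.single u 2) v 1 :=
      ⟨_, .single ⟨u, v, huv, by simp, rfl⟩, by simp⟩
    have hB : PebbSolvable G (C - Pi.single u 2) v m := by
      refine ih _ ?_
      simp only [Pi.sub_apply, Pi.single_eq_same]
      omega
    have hle : Pi.single u 2 ≤ C := by
      intro x
      by_cases hx : x = u
      · subst hx
        simp only [Pi.single_eq_same]
        omega
      · simp [hx]
    have := hB.add hA
    rwa [tsub_add_cancel_of_le hle] at this

theorem PebbSolvable.of_adj {C : V → ℕ} {u v : V} {k : ℕ} (huv : G.Adj u v)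
    (h : PebbSolvable G C u (2 * k)) : PebbSolvable G C v k := by
  obtain ⟨C', hC, hk⟩ := h
  exact .of_reflTransGen hC (exists_reflTransGen_of_adj huv k C' hk)

theorem PebbSolvable.of_walk {u r : V} (p : G.Walk u r) {C : V → ℕ} {k : ℕ}
    (h : PebbSolvable G C u (2 ^ p.length * k)) : PebbSolvable G C r k := by
  induction p with
  | nil => simpa using h
  | cons huv p ih =>
    refine ih (.of_adj huv ?_)
    rwa [SimpleGraph.Walk.length_cons, pow_succ', mul_assoc] at h

variable [Fintype V]

theorem exists_forall_pebbSolvable (hG : G.Connected) (k : ℕ) :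
    ∃ n, ∀ (r : V) (C : V → ℕ), n ≤ ∑ v, C v → PebbSolvable G C r k := by
  have := hG.nonempty
  refine ⟨∑ r : V, ∑ v : V, 2 ^ G.dist v r * k, fun r C hC => ?_⟩
  have hle : ∑ v : V, 2 ^ G.dist v r * k ≤ ∑ v, C v :=
    (Finset.single_le_sum (f := fun r => ∑ v : V, 2 ^ G.dist v r * k)
      (fun _ _ => Nat.zero_le _) (Finset.mem_univ r)).trans hC
  obtain ⟨v, -, hv⟩ := Finset.exists_le_of_sum_le Finset.univ_nonempty hle
  obtain ⟨p, hp⟩ := hG.exists_walk_length_eq_dist v r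
  exact .of_walk p (.of_le (by rwa [hp]))

theorem pebbSolvable_of_pebblingNumber_le (hG : G.Connected) {C : V → ℕ} (r : V)
    (h : pebblingNumber G ≤ ∑ v, C v) : PebbSolvable G C r 1 :=
  Nat.sInf_mem (exists_forall_pebbSolvable hG 1) r C h

/-- With twice the pebbling number, two pebbles can be moved to any vertex. -/
theorem pebbSolvable_two_of_two_mul_pebblingNumber_le (hG : G.Connected) {C : V → ℕ} (r : V)
    (h : 2 * pebblingNumber G ≤ ∑ v, C v) : PebbSolvable G C r 2 := by
  obtain ⟨A, hA, hn⟩ := exists_le_sum_eq_s13 C (n := pebblingNumber G) (by omega)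
  have hsum := sum_add_sum_tsub hA
  have := (pebbSolvable_of_pebblingNumber_le hG r hn.ge).add
    (pebbSolvable_of_pebblingNumber_le hG (C := C - A) r (by omega))
  rwa [add_tsub_cancel_of_le hA] at this

/-- One pebble already on the root, together with the pebbling number of further pebbles,
yields two pebbles on the root. -/
theorem pebbSolvable_two_of_pebblingNumber_lt (hG : G.Connected) {C : V → ℕ} (r : V)
    (h : pebblingNumber G + 1 ≤ ∑ v, C v) (hr : 1 ≤ C r) : PebbSolvable G C r 2 := by
  have hA : Pi.single r 1 ≤ C := by
    intro x
    by_cases hx : x = r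
    · subst hx
      simpa using hr
    · simp [hx]
  have hsum := sum_add_sum_tsub hA
  rw [Finset.sum_pi_single'] at hsum
  simp only [Finset.mem_univ, if_true] at hsum
  have hone : PebbSolvable G (Pi.single r 1) r 1 := .of_le (by simp)
  have := hone.add (pebbSolvable_of_pebblingNumber_le hG (C := C - Pi.single r 1) r (by omega))
  rwa [add_tsub_cancel_of_le hA] at this

end Pebbling

section Corona

variable {V W : Type*} {G : SimpleGraph V} {H : SimpleGraph W}

theorem corona_adj_inl_inl {u v : V} (h : G.Adj u v) :
    (corona G H).Adj (Sum.inl u) (Sum.inl v) := by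
  simp [corona, h, h.ne]

theorem corona_adj_inl_inr (g : V) (w : W) :
    (corona G H).Adj (Sum.inl g) (Sum.inr (g, w)) := by
  simp [corona]

/-- Pebbling within the copy of `G` takes place inside the corona. -/
theorem PebbSolvable.corona [DecidableEq V] [DecidableEq W] {C : V ⊕ V × W → ℕ} {r : V} {k : ℕ}
    (h : PebbSolvable G (fun v => C (Sum.inl v)) r k) :
    PebbSolvable (corona G H) C (Sum.inl r) k := by
  obtain ⟨A, hA, hk⟩ := h
  refine ⟨Sum.elim A (fun x => C (Sum.inr x)), ?_, hk⟩
  have := Relation.ReflTransGen.lift (p := PebblingStep (_root_.corona G H))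
    (fun A : V → ℕ => Sum.elim A (fun x => C (Sum.inr x))) ?_ _ _ hA
  · rwa [Function.onFun, show Sum.elim (fun v => C (Sum.inl v)) (fun x => C (Sum.inr x)) = C from
      Sum.elim_comp_inl_inr C] at this
  · rintro A _ ⟨u, v, huv, h2, rfl⟩
    refine ⟨Sum.inl u, Sum.inl v, corona_adj_inl_inl huv, h2, ?_⟩
    rw [Sum.update_elim_inl, Sum.update_elim_inl]
    rfl

end Corona

/-- In the corona `G ⋈ H` of a connected graph `G`:
(a) any configuration with at least `2π(G)` pebbles on the copy of `G` is `r`-solvable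
for every root `r`; and (b) if the root lies in the copy of `H` attached to `g`, any
configuration with at least `π(G) + 1` pebbles on the copy of `G`, at least one of
which is on `g`, is solvable. -/
theorem corona_solvable_of_pebbles_on_G {V W : Type*} [Fintype V] [DecidableEq V]
    [Fintype W] [DecidableEq W] (G : SimpleGraph V) (H : SimpleGraph W)
    (hG : G.Connected) :
    (∀ (C : V ⊕ V × W → ℕ) (r : V ⊕ V × W),
      2 * pebblingNumber G ≤ ∑ v : V, C (Sum.inl v) →
      PebbSolvable (corona G H) C r 1) ∧
    (∀ (C : V ⊕ V × W → ℕ) (g : V) (h : W),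
      pebblingNumber G + 1 ≤ ∑ v : V, C (Sum.inl v) →
      1 ≤ C (Sum.inl g) →
      PebbSolvable (corona G H) C (Sum.inr (g, h)) 1) := by
  refine ⟨fun C r hC => ?_, fun C g h hC hg => ?_⟩
  · obtain g | ⟨g, h⟩ := r
    · exact (pebbSolvable_of_pebblingNumber_le hG g (by omega)).corona
    · exact .of_adj (corona_adj_inl_inr g h)
        (pebbSolvable_two_of_two_mul_pebblingNumber_le hG g hC).corona
  · exact .of_adj (corona_adj_inl_inr g h)
      (pebbSolvable_two_of_pebblingNumber_lt hG g hC hg).corona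
end
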